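/- Let A be the elliptic curve X_0(14) with minimal Weierstrass equation y² + xy + y = x³ + 4x − 6, and let a_n denote the coefficients of its L-series. Then a_2 = −1, a_7 = 1, and for every odd prime q with (q,14) = 1: a_q ≡ 2 (mod 4) if q ≡ 1 (mod 8), or if q ≡ 3 (mod 8) and q is inert in Q(√−7), or if q ≡ 5 (mod 8) and q splits in Q(√−7); and a_q ≡ 0 (mod 4) if q ≡ 7 (mod 8), or if q ≡ 3 (mod 8) and q splits in Q(√−7), or if q ≡ 5 (mod 8) and q is inert in Q(√−7). -/

import Mathlib

/-- The number of projective points over `F_q` of the reduction modulo `q` of the minimal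
Weierstrass equation `y² + xy + y = x³ + 4x - 6` of the elliptic curve `A = X₀(14)`:
the affine points together with the single point at infinity. (For a prime `q` of good
reduction this is `#A(F_q)`; for the bad primes `2` and `7` this count of points of the
singular reduced cubic equals `q + 1 - a_q` for the multiplicative-reduction coefficient
`a_q = ±1`.) -/
noncomputable def X014Count (q : ℕ) : ℕ :=
  1 + Nat.card {P : ZMod q × ZMod q //
    P.2 ^ 2 + P.1 * P.2 + P.2 = P.1 ^ 3 + 4 * P.1 - 6}

/-- The coefficient `a_q` of the `L`-series of the elliptic curve `A = X₀(14)` at a prime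
`q`, namely `a_q = q + 1 - #A(F_q)`. -/
noncomputable def aX014 (q : ℕ) : ℤ :=
  (q : ℤ) + 1 - X014Count q

/-- The cubic `4u³ + 13u² + 32u`: completing the square and translating the rational `2`-torsion
point to the origin turns the equation of `A` into `v² = 4u³ + 13u² + 32u`. -/
def twoTorsionCubic {F : Type*} [Field F] (u : F) : F :=
  u * (4 * u ^ 2 + 13 * u + 32)

section FiniteField

variable {F : Type*} [Field F]

lemma eight_ne_zero_of_two_ne_zero (h2 : (2 : F) ≠ 0) : (8 : F) ≠ 0 := by
  have : (8 : F) = 2 ^ 3 := by norm_num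
  rw [this]
  exact pow_ne_zero _ h2

/-- Translation by the `2`-torsion point acts on the `u`-coordinate by `u ↦ 8 / u`. -/
lemma twoTorsionCubic_eight_div {u : F} (hu : u ≠ 0) :
    twoTorsionCubic (8 / u) = twoTorsionCubic u * (8 / u ^ 2) ^ 2 := by
  unfold twoTorsionCubic
  field_simp
  ring

lemma isSquare_twoTorsionCubic_eight_div (h2 : (2 : F) ≠ 0) {u : F} (hu : u ≠ 0) :
    IsSquare (twoTorsionCubic (8 / u)) ↔ IsSquare (twoTorsionCubic u) := by
  have h8 : (8 : F) ≠ 0 := eight_ne_zero_of_two_ne_zero h2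
  have hc : (8 / u ^ 2 : F) ≠ 0 := div_ne_zero h8 (pow_ne_zero _ hu)
  rw [twoTorsionCubic_eight_div hu]
  constructor
  · rintro ⟨r, hr⟩
    refine ⟨r / (8 / u ^ 2), ?_⟩
    rw [div_mul_div_comm, ← hr]
    field_simp
  · rintro ⟨r, hr⟩
    exact ⟨r * (8 / u ^ 2), by rw [hr]; ring⟩

variable [Fintype F] [DecidableEq F]

lemma card_twoTorsionCubic_eq_zero_of_isSquare (h2 : (2 : F) ≠ 0) (h7 : (7 : F) ≠ 0)
    (hs : IsSquare (-7 : F)) :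
    (Finset.univ.filter fun u : F => twoTorsionCubic u = 0).card = 3 := by
  obtain ⟨s, hs⟩ := hs
  have hs0 : s ≠ 0 := by
    rintro rfl
    exact h7 (by linear_combination -hs)
  have h8 : (8 : F) ≠ 0 := eight_ne_zero_of_two_ne_zero h2
  have h512 : (512 : F) ≠ 0 := by
    have : (512 : F) = 2 ^ 9 := by norm_num
    rw [this]; exact pow_ne_zero _ h2
  set a : F := (-13 + 7 * s) / 8 with ha
  set b : F := (-13 - 7 * s) / 8 with hb
  have ha' : 8 * a = -13 + 7 * s := by rw [ha]; field_simp
  have hb' : 8 * b = -13 - 7 * s := by rw [hb]; field_simp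
  have hab : 64 * (a * b) = 512 := by linear_combination 8 * b * ha' + (-13 + 7 * s) * hb' + 49 * hs
  have ha0 : a ≠ 0 := by
    intro h
    exact h512 (by rw [← hab, h]; ring)
  have hb0 : b ≠ 0 := by
    intro h
    exact h512 (by rw [← hab, h]; ring)
  have hne : a ≠ b := by
    intro h
    have : 2 * 7 * s = 0 := by linear_combination hb' - ha' + 8 * h
    simp_all
  have hset : (Finset.univ.filter fun u : F => twoTorsionCubic u = 0) = {0, a, b} := by
    ext u
    have key : 16 * twoTorsionCubic u = u * (8 * (u - a)) * (8 * (u - b)) := by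
      unfold twoTorsionCubic
      linear_combination (8 * u ^ 2) * (ha' + hb') - u * hab
    have h16 : (16 : F) ≠ 0 := by
      have : (16 : F) = 2 ^ 4 := by norm_num
      rw [this]; exact pow_ne_zero _ h2
    simp only [Finset.mem_filter, Finset.mem_univ, true_and, Finset.mem_insert,
      Finset.mem_singleton]
    constructor
    · intro h
      rw [h, mul_zero] at key
      simpa [h8, sub_eq_zero, or_assoc] using key.symm
    · intro h
      refine (mul_eq_zero.1 (key.trans ?_)).resolve_left h16
      rcases h with rfl | rfl | rfl <;> ring
  rw [hset, Finset.card_eq_three]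
  exact ⟨0, a, b, ha0.symm, hb0.symm, hne, rfl⟩

lemma card_twoTorsionCubic_eq_zero_of_not_isSquare (h7 : (7 : F) ≠ 0)
    (hs : ¬ IsSquare (-7 : F)) :
    (Finset.univ.filter fun u : F => twoTorsionCubic u = 0).card = 1 := by
  rw [Finset.card_eq_one]
  refine ⟨0, ?_⟩
  ext u
  simp only [Finset.mem_filter, Finset.mem_univ, true_and, Finset.mem_singleton]
  constructor
  · intro h
    refine (mul_eq_zero.1 h).resolve_right fun hq => hs ⟨(8 * u + 13) / 7, ?_⟩
    field_simp
    linear_combination -16 * hq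
  · rintro rfl
    simp [twoTorsionCubic]

/-- The parity of the number of nonsquare values is governed by the fixed points of `u ↦ 8 / u`. -/
lemma card_not_isSquare_twoTorsionCubic_modEq (h2 : (2 : F) ≠ 0) :
    (Finset.univ.filter fun u : F => ¬ IsSquare (twoTorsionCubic u)).card ≡
      (Finset.univ.filter fun u : F => ¬ IsSquare (twoTorsionCubic u) ∧ u ^ 2 = 8).card
      [MOD 2] := by
  have h8 : (8 : F) ≠ 0 := eight_ne_zero_of_two_ne_zero h2
  have h0 : ∀ u : F, ¬ IsSquare (twoTorsionCubic u) → u ≠ 0 := by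
    rintro u hu rfl
    exact hu (by simp [twoTorsionCubic])
  rw [← Finset.card_filter_add_card_filter_not (fun u : F => u ^ 2 = 8), Finset.filter_filter,
    Finset.filter_filter]
  suffices h : ((Finset.univ.filter fun u : F =>
      ¬ IsSquare (twoTorsionCubic u) ∧ ¬ u ^ 2 = 8).card : ZMod 2) = 0 by
    rw [← ZMod.natCast_eq_natCast_iff, Nat.cast_add, h, add_zero]
  rw [Finset.cast_card]
  refine Finset.sum_involution (fun u _ => 8 / u) ?_ ?_ ?_ ?_
  · intros; decide
  · intro u hu _ h
    simp only [Finset.mem_filter, Finset.mem_univ, true_and] at hu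
    have := h0 u hu.1
    rw [div_eq_iff this] at h
    exact hu.2 (by rw [h]; ring)
  · intro u hu
    simp only [Finset.mem_filter, Finset.mem_univ, true_and] at hu ⊢
    have hu0 := h0 u hu.1
    refine ⟨(isSquare_twoTorsionCubic_eight_div h2 hu0).not.2 hu.1, fun h => hu.2 ?_⟩
    field_simp at h
    rw [← h]
  · intro u hu
    simp only [Finset.mem_filter, Finset.mem_univ, true_and] at hu
    have := h0 u hu.1
    field_simp

lemma card_fixedPoints_of_not_isSquare_two (h2 : (2 : F) ≠ 0) (hs : ¬ IsSquare (2 : F)) :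
    (Finset.univ.filter fun u : F => ¬ IsSquare (twoTorsionCubic u) ∧ u ^ 2 = 8).card = 0 := by
  rw [Finset.card_eq_zero, Finset.filter_eq_empty_iff]
  rintro u - ⟨-, hu⟩
  refine hs ⟨u / 2, ?_⟩
  field_simp
  rw [hu]
  norm_num

lemma quadraticChar_twoTorsionCubic_mul_neg (h2 : (2 : F) ≠ 0) (h7 : (7 : F) ≠ 0) {u : F}
    (hu : u ^ 2 = 8) :
    quadraticChar F (twoTorsionCubic u) * quadraticChar F (twoTorsionCubic (-u)) =
      quadraticChar F (-7) := by
  have h56 : (56 : F) ≠ 0 := by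
    have : (56 : F) = 2 ^ 3 * 7 := by norm_num
    rw [this]; exact mul_ne_zero (pow_ne_zero _ h2) h7
  have : twoTorsionCubic u * twoTorsionCubic (-u) = -7 * 56 ^ 2 := by
    unfold twoTorsionCubic
    linear_combination (-16 * u ^ 4 - 215 * u ^ 2 - 2744) * hu
  rw [← map_mul, this, map_mul, quadraticChar_sq_one' h56, mul_one]

lemma card_fixedPoints_eq_of_sq_eq_eight (h2 : (2 : F) ≠ 0) {w : F} (hw : w ^ 2 = 8) :
    (Finset.univ.filter fun u : F => ¬ IsSquare (twoTorsionCubic u) ∧ u ^ 2 = 8).card =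
      (if IsSquare (twoTorsionCubic w) then 0 else 1) +
        (if IsSquare (twoTorsionCubic (-w)) then 0 else 1) := by
  have hne : w ≠ -w := by
    intro h
    have h2w : 2 * w = 0 := by linear_combination h
    have hw0 : w = 0 := (mul_eq_zero.1 h2w).resolve_left h2
    have : (2 : F) ^ 3 = 0 := by rw [hw0] at hw; linear_combination -hw
    exact h2 (pow_eq_zero_iff (by norm_num) |>.1 this)
  have hset : (Finset.univ.filter fun u : F => ¬ IsSquare (twoTorsionCubic u) ∧ u ^ 2 = 8) =
      ({w, -w} : Finset F).filter fun u => ¬ IsSquare (twoTorsionCubic u) := by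
    ext u
    simp only [Finset.mem_filter, Finset.mem_univ, true_and, Finset.mem_insert,
      Finset.mem_singleton, ← hw, sq_eq_sq_iff_eq_or_eq_neg]
    tauto
  rw [hset, Finset.card_filter, Finset.sum_pair hne]
  simp only [ite_not]

lemma card_fixedPoints_of_isSquare (h2 : (2 : F) ≠ 0) (h7 : (7 : F) ≠ 0)
    (hs : IsSquare (-7 : F)) :
    (Finset.univ.filter fun u : F => ¬ IsSquare (twoTorsionCubic u) ∧ u ^ 2 = 8).card ≡ 0
      [MOD 2] := by
  by_cases ht : IsSquare (2 : F)
  · obtain ⟨t, ht⟩ := ht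
    have hw : (2 * t) ^ 2 = 8 := by linear_combination -4 * ht
    have hχ := quadraticChar_twoTorsionCubic_mul_neg h2 h7 hw
    rw [(quadraticChar_one_iff_isSquare (neg_ne_zero.2 h7)).2 hs] at hχ
    have hiff : IsSquare (twoTorsionCubic (2 * t)) ↔ IsSquare (twoTorsionCubic (-(2 * t))) := by
      rw [← not_iff_not, ← quadraticChar_neg_one_iff_not_isSquare,
        ← quadraticChar_neg_one_iff_not_isSquare]
      constructor <;> intro h <;> rw [h] at hχ <;> linarith
    rw [card_fixedPoints_eq_of_sq_eq_eight h2 hw]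
    split_ifs <;> first | decide | tauto
  · rw [card_fixedPoints_of_not_isSquare_two h2 ht]

lemma card_fixedPoints_of_isSquare_two_of_not_isSquare (h2 : (2 : F) ≠ 0) (h7 : (7 : F) ≠ 0)
    (ht : IsSquare (2 : F)) (hs : ¬ IsSquare (-7 : F)) :
    (Finset.univ.filter fun u : F => ¬ IsSquare (twoTorsionCubic u) ∧ u ^ 2 = 8).card = 1 := by
  obtain ⟨t, ht⟩ := ht
  have hw : (2 * t) ^ 2 = 8 := by linear_combination -4 * ht
  have hχ := quadraticChar_twoTorsionCubic_mul_neg h2 h7 hw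
  rw [quadraticChar_neg_one_iff_not_isSquare.2 hs] at hχ
  have h₁ : twoTorsionCubic (2 * t) ≠ 0 := by
    intro h
    simp [h] at hχ
  have h₂ : twoTorsionCubic (-(2 * t)) ≠ 0 := by
    intro h
    simp [h] at hχ
  rw [card_fixedPoints_eq_of_sq_eq_eight h2 hw]
  split_ifs with h h₃ h₃
  · rw [← quadraticChar_one_iff_isSquare h₁] at h
    rw [← quadraticChar_one_iff_isSquare h₂] at h₃
    norm_num [h, h₃] at hχ
  · rfl
  · rfl
  · rw [← quadraticChar_neg_one_iff_not_isSquare] at h h₃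
    norm_num [h, h₃] at hχ

lemma sum_quadraticChar_twoTorsionCubic :
    ∑ u : F, quadraticChar F (twoTorsionCubic u) = (Fintype.card F : ℤ) -
      (Finset.univ.filter fun u : F => twoTorsionCubic u = 0).card -
      2 * (Finset.univ.filter fun u : F => ¬ IsSquare (twoTorsionCubic u)).card := by
  have hχ : ∀ a : F, quadraticChar F a =
      1 - (if a = 0 then 1 else 0) - 2 * (if ¬ IsSquare a then 1 else 0) := by
    intro a
    rw [quadraticChar_apply, quadraticCharFun]
    split_ifs <;> simp_all
  simp only [hχ, Finset.sum_sub_distrib, ← Finset.mul_sum, Finset.sum_boole, Finset.sum_const,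
    Finset.card_univ, nsmul_eq_mul, mul_one]

/-- Completing the square: `(x, y) ↦ (x - 1, 2 * y + x + 1)`. -/
lemma natCard_weierstrass_eq (h2 : (2 : F) ≠ 0) :
    (Nat.card {P : F × F // P.2 ^ 2 + P.1 * P.2 + P.2 = P.1 ^ 3 + 4 * P.1 - 6} : ℤ) =
      Fintype.card F + ∑ u : F, quadraticChar F (twoTorsionCubic u) := by
  have hchar : ringChar F ≠ 2 := by
    intro h
    exact h2 (by simpa [h] using ringChar.Nat.cast_ringChar (R := F))
  let e : {P : F × F // P.2 ^ 2 + P.1 * P.2 + P.2 = P.1 ^ 3 + 4 * P.1 - 6} ≃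
      Σ u : F, {v : F // v ^ 2 = twoTorsionCubic u} :=
    { toFun := fun P => ⟨P.1.1 - 1, 2 * P.1.2 + P.1.1 + 1, by
        unfold twoTorsionCubic
        linear_combination 4 * P.2⟩
      invFun := fun Q => ⟨(Q.1 + 1, (Q.2.1 - Q.1 - 2) / 2), by
        have hQ := Q.2.2
        unfold twoTorsionCubic at hQ
        field_simp
        linear_combination hQ⟩
      left_inv := by
        rintro ⟨⟨x, y⟩, h⟩
        ext
        · simp
        · simp only
          field_simp
          ring
      right_inv := by
        rintro ⟨u, v, h⟩
        have h₁ : u + 1 - 1 = u := by ring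
        have h₂ : 2 * ((v - u - 2) / 2) + (u + 1) + 1 = v := by
          field_simp
          ring
        exact Sigma.subtype_ext h₁ h₂ }
  rw [Nat.card_congr e, Nat.card_sigma, Nat.cast_sum]
  have hfib : ∀ u : F, (Nat.card {v : F // v ^ 2 = twoTorsionCubic u} : ℤ) =
      quadraticChar F (twoTorsionCubic u) + 1 := by
    intro u
    rw [← quadraticChar_card_sqrts hchar, Nat.card_eq_fintype_card, Set.toFinset_card]
    rfl
  simp only [hfib, Finset.sum_add_distrib, Finset.sum_const, Finset.card_univ, nsmul_eq_mul,
    mul_one]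
  ring

end FiniteField

lemma aX014_eq {q : ℕ} [Fact q.Prime] (h2 : (2 : ZMod q) ≠ 0) :
    aX014 q = -(q : ℤ) +
      (Finset.univ.filter fun u : ZMod q => twoTorsionCubic u = 0).card +
      2 * (Finset.univ.filter fun u : ZMod q => ¬ IsSquare (twoTorsionCubic u)).card := by
  rw [aX014, X014Count, Nat.cast_add, natCard_weierstrass_eq h2,
    sum_quadraticChar_twoTorsionCubic, ZMod.card]
  push_cast
  ring

/-- Let `A` be the elliptic curve `X₀(14)` with minimal Weierstrass
equation `y² + xy + y = x³ + 4x - 6`, and let `aₙ` denote the coefficients of its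
`L`-series. Then `a₂ = -1`, `a₇ = 1`, and for every odd prime `q` with `(q,14) = 1`:
`a_q ≡ 2 (mod 4)` if `q ≡ 1 (mod 8)`, or if `q ≡ 3 (mod 8)` and `q` is inert in
`ℚ(√-7)`, or if `q ≡ 5 (mod 8)` and `q` splits in `ℚ(√-7)`; and `a_q ≡ 0 (mod 4)` if
`q ≡ 7 (mod 8)`, or if `q ≡ 3 (mod 8)` and `q` splits in `ℚ(√-7)`, or if `q ≡ 5 (mod 8)`
and `q` is inert in `ℚ(√-7)`. (For an odd prime `q ∤ 7`, `q` splits in `ℚ(√-7)` iff `-7`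
is a square modulo `q`, and is inert iff it is not.) -/
theorem stmt13 :
    aX014 2 = -1 ∧ aX014 7 = 1 ∧
    ∀ q : ℕ, q.Prime → Odd q → Nat.Coprime q 14 →
      ((q % 8 = 1 → aX014 q % 4 = 2) ∧
       (q % 8 = 3 → ¬ IsSquare (-7 : ZMod q) → aX014 q % 4 = 2) ∧
       (q % 8 = 5 → IsSquare (-7 : ZMod q) → aX014 q % 4 = 2) ∧
       (q % 8 = 7 → aX014 q % 4 = 0) ∧
       (q % 8 = 3 → IsSquare (-7 : ZMod q) → aX014 q % 4 = 0) ∧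
       (q % 8 = 5 → ¬ IsSquare (-7 : ZMod q) → aX014 q % 4 = 0)) := by
  refine ⟨?_, ?_, ?_⟩
  · rw [aX014, X014Count, Nat.card_eq_fintype_card]
    decide
  · rw [aX014, X014Count, Nat.card_eq_fintype_card]
    decide
  intro q hq hodd hcop
  have : Fact q.Prime := ⟨hq⟩
  have hq2 : q ≠ 2 := by
    rintro rfl
    exact absurd hodd (by decide)
  have h2 : (2 : ZMod q) ≠ 0 := by
    intro h
    have := (ZMod.natCast_eq_zero_iff 2 q).1 (by exact_mod_cast h)
    exact hq2 ((Nat.prime_dvd_prime_iff_eq hq Nat.prime_two).1 this)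
  have h7 : (7 : ZMod q) ≠ 0 := by
    intro h
    have := (ZMod.natCast_eq_zero_iff 7 q).1 (by exact_mod_cast h)
    have := (Nat.prime_dvd_prime_iff_eq hq (by norm_num : Nat.Prime 7)).1 this
    subst this
    exact absurd hcop (by decide)
  have htwo : IsSquare (2 : ZMod q) ↔ q % 8 = 1 ∨ q % 8 = 7 := ZMod.exists_sq_eq_two_iff hq2
  have ha := aX014_eq h2
  have hpar := card_not_isSquare_twoTorsionCubic_modEq h2
  rw [Nat.ModEq] at hpar
  by_cases hs : IsSquare (-7 : ZMod q)
  · have hfix := card_fixedPoints_of_isSquare h2 h7 hs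
    rw [card_twoTorsionCubic_eq_zero_of_isSquare h2 h7 hs] at ha
    rw [Nat.ModEq] at hfix
    simp only [hs, not_true_eq_false, false_imp_iff, imp_true_iff, true_and, and_true, true_imp_iff]
    refine ⟨?_, ?_, ?_, ?_⟩ <;> omega
  · rw [card_twoTorsionCubic_eq_zero_of_not_isSquare h7 hs] at ha
    simp only [hs, not_false_eq_true, false_imp_iff, imp_true_iff, true_and, true_imp_iff]
    by_cases ht : IsSquare (2 : ZMod q)
    · rw [card_fixedPoints_of_isSquare_two_of_not_isSquare h2 h7 ht hs] at hpar
      have := htwo.1 ht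
      omega
    · rw [card_fixedPoints_of_not_isSquare_two h2 ht] at hpar
      have := htwo.not.1 ht
      omega
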